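/- If a digraph G contains a directed cycle, then the temporality of G with respect to the all-paths property is at least 2; that is, every labeling that preserves all simple paths of G must assign at least 2 labels to some edge. -/

import Mathlib

/-- `w` is a simple path of the digraph with edge relation `E`: a sequence of
`k + 1` distinct vertices joined by consecutive edges. -/
def IsPath {V : Type*} (E : V → V → Prop) {k : ℕ} (w : Fin (k + 1) → V) : Prop :=
  Function.Injective w ∧ ∀ i : Fin k, E (w i.castSucc) (w i.succ)

/-- The labeling `lab` preserves the path `w`: there is a strictly increasing
choice of labels along the consecutive edges of `w`. -/
def Preserves {V : Type*} (lab : V → V → Finset ℕ) {k : ℕ} (w : Fin (k + 1) → V) : Prop :=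
  ∃ l : Fin k → ℕ, StrictMono l ∧ ∀ i : Fin k, l i ∈ lab (w i.castSucc) (w i.succ)

/-- The labeling `lab` preserves every simple path of the digraph `E`
(the "all paths" property). -/
def PreservesAll {V : Type*} (E : V → V → Prop) (lab : V → V → Finset ℕ) : Prop :=
  ∀ (k : ℕ) (w : Fin (k + 1) → V), IsPath E w → Preserves lab w

/-- If a digraph contains a directed cycle (a ring, i.e. a cyclic sequence of at
least 3 distinct vertices joined by consecutive edges), then every labeling
preserving all simple paths must assign at least 2 labels to some edge;
that is, τ(G, all paths) ≥ 2. -/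
theorem temporality_all_paths_ge_two_of_cycle {V : Type*} (E : V → V → Prop)
    (hcyc : ∃ (k : ℕ) (w : Fin (k + 3) → V),
      Function.Injective w ∧ ∀ i : Fin (k + 3), E (w i) (w (i + 1))) :
    ∀ lab : V → V → Finset ℕ, PreservesAll E lab →
      ∃ u v, E u v ∧ 2 ≤ (lab u v).card := by
  intro lab hlab
  obtain ⟨k, w, hw, hE⟩ := hcyc
  by_contra! hcard
  have hlt : ∀ i : Fin (k + 3),
      (lab (w i) (w (i + 1))).sup id < (lab (w (i + 1)) (w (i + 1 + 1))).sup id := by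
    intro i
    have h01 : i ≠ i + 1 := by simp
    have h12 : i + 1 ≠ i + 1 + 1 := by simp
    have h02 : i ≠ i + 1 + 1 := by
      intro h
      rw [add_assoc, left_eq_add] at h
      have h2 := congrArg Fin.val h
      simp [Fin.val_add, Nat.mod_eq_of_lt] at h2
    have hpath : IsPath E (k := 2) ![w i, w (i + 1), w (i + 1 + 1)] := by
      constructor
      · intro a b hab
        fin_cases a <;> fin_cases b <;>
          simp_all [hw.eq_iff]
      · intro j
        fin_cases j
        · exact hE i
        · exact hE (i + 1)
    obtain ⟨l, hl, hmem⟩ := hlab 2 _ hpath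
    have h0 : l 0 ∈ lab (w i) (w (i + 1)) := hmem 0
    have h1 : l 1 ∈ lab (w (i + 1)) (w (i + 1 + 1)) := hmem 1
    have hsup : (lab (w i) (w (i + 1))).sup id ≤ l 0 := by
      refine Finset.sup_le fun x hx => ?_
      exact (Finset.card_le_one.mp (Nat.lt_succ_iff.mp (hcard _ _ (hE i))) x hx _ h0).le
    calc _ ≤ l 0 := hsup
      _ < l 1 := hl (by decide)
      _ ≤ _ := Finset.le_sup (f := id) h1
  obtain ⟨m, hm⟩ := Finite.exists_max fun i : Fin (k + 3) => (lab (w i) (w (i + 1))).sup id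
  exact (hlt m).not_ge (hm (m + 1))
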